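/- Fix t > 0. Let U0 be a real random variable, let f0 : [0,∞)×ℝ → [0,∞) and f1 : [0,∞) → [0,∞) be measurable (homogeneous causal effect: f1 does not depend on an individual modifier), and set Λ^a(s,u0) = ∫_0^s f0(r,u0)f1(r) dr and Λ^0(s,u0) = ∫_0^s f0(r,u0) dr. Let T^a and T^0 be nonnegative random variables whose conditional survivals given U0 are exp(−Λ^a(s,U0)) and exp(−Λ^0(s,U0)) respectively. Assume that for each u0 the map s ↦ f0(s,u0)f1(s) and s ↦ f0(s,u0) are nondecreasing and continuous on [t, t+h̃], that E[f0(t+h,U0)f1(t+h)·1{T^a ≥ t}] < ∞ and E[f0(t+h,U0)·1{T^0 ≥ t}] < ∞ for all h ∈ (0,h̃), and that P(T^a ≥ t) > 0, P(T^0 ≥ t) > 0 and E[f0(t,U0)·exp(−Λ^0(t,U0))] > 0. Then the marginal hazards of T^a and T^0 at t exist and λ_{T^a}(t)/λ_{T^0}(t) = (E[f0(t,U0) | T^a ≥ t] / E[f0(t,U0) | T^0 ≥ t]) · f1(t), i.e., the marginal causal hazard ratio equals the causal hazard ratio f1(t) multiplied by the ratio of the conditional expected frailty factors among survivors in the two worlds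 (Corollary 4.1.1). -/

import Mathlib

open MeasureTheory Real Set Filter Topology

lemma aux_hazard
    {Ω : Type*} [MeasurableSpace Ω] (P : Measure Ω) [IsProbabilityMeasure P]
    (U : Ω → ℝ) (hU : Measurable U)
    (T : Ω → ℝ) (hT : Measurable T)
    (g : ℝ → ℝ → ℝ) (hg : Measurable (Function.uncurry g)) (hgnn : ∀ s u, 0 ≤ g s u)
    (L : ℝ → ℝ → ℝ) (hL : ∀ s u, L s u = ∫ r in (0:ℝ)..s, g r u)
    (hsurv : ∀ s : ℝ, 0 ≤ s → ∀ B : Set ℝ, MeasurableSet B →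
      (P {ω | s ≤ T ω ∧ U ω ∈ B}).toReal
        = ∫ ω, B.indicator (fun _ => (1:ℝ)) (U ω) * Real.exp (-(L s (U ω))) ∂P)
    (t : ℝ) (ht : 0 < t) (k : ℝ) (hk : 0 < k)
    (hmono : ∀ u, MonotoneOn (fun s => g s u) (Icc t (t + k)))
    (hcont : ∀ u, ContinuousOn (fun s => g s u) (Icc t (t + k)))
    (hint : ∀ h : ℝ, h ∈ Ioo 0 k →
      ∫⁻ ω in {ω | t ≤ T ω}, ENNReal.ofReal (g (t + h) (U ω)) ∂P < ⊤) :
    Tendsto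
        (fun h : ℝ => h⁻¹ * ((ProbabilityTheory.cond P {ω | t ≤ T ω})
            {ω | T ω ∈ Ico t (t + h)}).toReal)
        (𝓝[>] 0) (𝓝 ((∫ ω in {ω | t ≤ T ω}, g t (U ω) ∂P) / (P {ω | t ≤ T ω}).toReal)) := by
  have hgs : StronglyMeasurable (Function.uncurry (fun u r => g r u)) :=
    (hg.comp measurable_swap).stronglyMeasurable
  have hgr : ∀ r, Measurable (fun u => g r u) := fun r =>
    hg.comp (measurable_const.prodMk measurable_id)
  have hTs : ∀ s, MeasurableSet {ω | s ≤ T ω} := fun s => measurableSet_le measurable_const hT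
  have hIm : ∀ a b, a ≤ b → Measurable (fun u => ∫ r in a..b, g r u) := by
    intro a b hab
    simp only [intervalIntegral.integral_of_le hab]
    exact (hgs.integral_prod_right (ν := volume.restrict (Ioc a b))).measurable
  have hInn : ∀ a b, a ≤ b → ∀ u, 0 ≤ ∫ r in a..b, g r u := fun a b hab u =>
    intervalIntegral.integral_nonneg_of_forall hab (fun r => hgnn r u)
  have hLm : ∀ s, 0 ≤ s → Measurable (L s) := by
    intro s hs
    have : L s = fun u => ∫ r in (0:ℝ)..s, g r u := funext (hL s)
    rw [this]; exact hIm 0 s hs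
  have hLnn : ∀ s, 0 ≤ s → ∀ u, 0 ≤ L s u := fun s hs u => by rw [hL]; exact hInn 0 s hs u
  set μ := P.map U with hμ
  haveI : IsProbabilityMeasure μ := Measure.isProbabilityMeasure_map hU.aemeasurable
  -- survival in terms of μ
  have hexpm : ∀ s, 0 ≤ s → Measurable (fun u => Real.exp (-(L s u))) := fun s hs =>
    (hLm s hs).neg.exp
  have hexpi : ∀ s, 0 ≤ s → Integrable (fun u => Real.exp (-(L s u))) μ := by
    intro s hs
    refine Integrable.of_bound (hexpm s hs).aestronglyMeasurable 1 (ae_of_all _ fun u => ?_)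
    rw [Real.norm_eq_abs, abs_of_pos (Real.exp_pos _)]
    exact Real.exp_le_one_iff.2 (by linarith [hLnn s hs u])
  have hsurv' : ∀ s : ℝ, 0 ≤ s → ∀ B : Set ℝ, MeasurableSet B →
      (P {ω | s ≤ T ω ∧ U ω ∈ B}).toReal = ∫ u in B, Real.exp (-(L s u)) ∂μ := by
    intro s hs B hB
    rw [hsurv s hs B hB, ← integral_indicator hB, hμ,
      integral_map hU.aemeasurable
        ((hexpm s hs).indicator hB).aestronglyMeasurable]
    congr 1; ext ω
    by_cases h : U ω ∈ B <;> simp [h]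
  -- a.e. integrability
  have hai : ∀ᵐ u ∂μ, IntegrableOn (fun r => g r u) (Ioc 0 t) volume := by
    have hGm : MeasurableSet {u | Integrable (fun r => g r u) (volume.restrict (Ioc 0 t))} :=
      measurableSet_integrable hgs
    set B := {u | Integrable (fun r => g r u) (volume.restrict (Ioc 0 t))}ᶜ with hBdef
    have hB : MeasurableSet B := hGm.compl
    have hconst : ∀ s, t ≤ s → (P {ω | s ≤ T ω ∧ U ω ∈ B}).toReal = μ.real B := by
      intro s hs
      rw [hsurv' s (ht.le.trans hs) B hB]
      have : ∀ u ∈ B, Real.exp (-(L s u)) = 1 := by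
        intro u hu
        rw [hL, intervalIntegral.integral_undef, neg_zero, Real.exp_zero]
        intro hi
        apply hu
        exact ((intervalIntegrable_iff_integrableOn_Ioc_of_le (ht.le.trans hs)).1 hi).mono_set
          (Ioc_subset_Ioc_right hs)
      rw [setIntegral_congr_fun hB this]
      simp
    have hlim : Tendsto (fun n : ℕ => P {ω | (n:ℝ) ≤ T ω ∧ U ω ∈ B}) atTop
        (𝓝 (P (⋂ n : ℕ, {ω | (n:ℝ) ≤ T ω ∧ U ω ∈ B}))) := by
      apply tendsto_measure_iInter_atTop
      · intro n
        exact ((hTs n).inter (hU hB)).nullMeasurableSet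
      · intro m n hmn ω hω
        exact ⟨le_trans (by exact_mod_cast hmn) hω.1, hω.2⟩
      · exact ⟨0, measure_ne_top _ _⟩
    have hemp : (⋂ n : ℕ, {ω | (n:ℝ) ≤ T ω ∧ U ω ∈ B}) = ∅ := by
      ext ω
      simp only [mem_iInter, mem_setOf_eq, mem_empty_iff_false, iff_false, not_forall]
      obtain ⟨n, hn⟩ := exists_nat_gt (T ω)
      exact ⟨n, fun h => absurd h.1 (not_le.2 hn)⟩
    rw [hemp, measure_empty] at hlim
    have hlim2 := (ENNReal.tendsto_toReal ENNReal.zero_ne_top).comp hlim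
    have hz : μ.real B = 0 := by
      refine tendsto_nhds_unique (tendsto_const_nhds.congr' ?_) hlim2
      obtain ⟨N, hN⟩ := exists_nat_ge t
      filter_upwards [eventually_ge_atTop N] with n hn
      exact (hconst n (hN.trans (by exact_mod_cast hn))).symm
    have hz' : μ B = 0 := by
      rwa [measureReal_eq_zero_iff] at hz
    exact hz'
  -- the survivors' law of U
  set ν := (P.restrict {ω | t ≤ T ω}).map U with hν
  have hνd : ν = μ.withDensity (fun u => ENNReal.ofReal (Real.exp (-(L t u)))) := by
    ext B hB
    rw [hν, Measure.map_apply hU hB, Measure.restrict_apply (hU hB), withDensity_apply _ hB,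
      ← ofReal_integral_eq_lintegral_ofReal (hexpi t ht.le).integrableOn
        (ae_of_all _ fun u => (Real.exp_pos _).le), ← hsurv' t ht.le B hB,
      ENNReal.ofReal_toReal (measure_ne_top _ _)]
    congr 1; ext ω; simp [and_comm]
  haveI : IsFiniteMeasure ν := by rw [hν]; infer_instance
  have hci : ∀ u a b, a ∈ Icc t (t+k) → b ∈ Icc t (t+k) →
      IntervalIntegrable (fun r => g r u) volume a b := fun u a b ha hb =>
    ((hcont u).mono (uIcc_subset_Icc ha hb)).intervalIntegrable
  have htk : t ∈ Icc t (t+k) := ⟨le_rfl, by linarith⟩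
  -- P(t+h ≤ T)
  have hPh : ∀ h, 0 ≤ h → h ≤ k → (P {ω | t + h ≤ T ω}).toReal
      = ∫ u, Real.exp (-(∫ r in t..(t+h), g r u)) ∂ν := by
    intro h h0 hhk
    have h1 := hsurv' (t+h) (by linarith) univ MeasurableSet.univ
    simp only [mem_univ, and_true, Measure.restrict_univ] at h1
    rw [h1, hνd, integral_withDensity_eq_integral_toReal_smul
      (hexpm t ht.le).ennreal_ofReal (ae_of_all _ fun u => ENNReal.ofReal_lt_top)]
    apply integral_congr_ae
    filter_upwards [hai] with u hu
    rw [ENNReal.toReal_ofReal (Real.exp_pos _).le, smul_eq_mul, ← Real.exp_add, hL, hL,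
      ← intervalIntegral.integral_add_adjacent_intervals
        ((intervalIntegrable_iff_integrableOn_Ioc_of_le ht.le).2 hu)
        (hci u t (t+h) htk ⟨by linarith, by linarith⟩)]
    ring_nf
  have hei : ∀ h, 0 ≤ h → Integrable (fun u => Real.exp (-(∫ r in t..(t+h), g r u))) ν := by
    intro h h0
    refine Integrable.of_bound (hIm t (t+h) (by linarith)).neg.exp.aestronglyMeasurable 1
      (ae_of_all _ fun u => ?_)
    rw [Real.norm_eq_abs, abs_of_pos (Real.exp_pos _)]
    exact Real.exp_le_one_iff.2 (by linarith [hInn t (t+h) (by linarith) u])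
  have hIco : ∀ h, 0 ≤ h → h ≤ k → (P {ω | T ω ∈ Ico t (t+h)}).toReal
      = ∫ u, (1 - Real.exp (-(∫ r in t..(t+h), g r u))) ∂ν := by
    intro h h0 hhk
    have e : {ω | T ω ∈ Ico t (t+h)} = {ω | t ≤ T ω} \ {ω | t + h ≤ T ω} := by
      ext ω; simp
    have h00 := hPh 0 le_rfl hk.le
    have hd := measureReal_diff (μ := P) (s₁ := {ω | t ≤ T ω}) (s₂ := {ω | t + h ≤ T ω})
      (fun ω hω => by simp only [mem_setOf_eq] at *; linarith) (hTs _)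
    simp only [measureReal_def] at hd
    rw [e, hd, integral_sub (integrable_const _) (hei h h0), ← hPh h h0 hhk]
    simp only [add_zero, intervalIntegral.integral_same, neg_zero, Real.exp_zero] at h00
    rw [h00]
  have hlim : Tendsto (fun h : ℝ => ∫ u, h⁻¹ * (1 - Real.exp (-(∫ r in t..(t+h), g r u))) ∂ν)
      (𝓝[>] 0) (𝓝 (∫ u, g t u ∂ν)) := by
    have hk2 : k/2 ∈ Ioo 0 k := ⟨by linarith, by linarith⟩
    apply tendsto_integral_filter_of_dominated_convergence (fun u => g (t + k/2) u)
    · filter_upwards [self_mem_nhdsWithin] with h hh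
      have hh : 0 < h := hh
      exact (((hIm t (t+h) (by linarith)).neg.exp.const_sub 1).const_mul _).aestronglyMeasurable
    · filter_upwards [Ioo_mem_nhdsGT hk2.1] with h hh
      refine ae_of_all _ fun u => ?_
      have hI := hInn t (t+h) (by linarith [hh.1]) u
      have hle : (∫ r in t..(t+h), g r u) ≤ h * g (t+k/2) u := by
        have := intervalIntegral.integral_mono_on (μ := volume) (a := t) (b := t+h)
          (f := fun r => g r u) (g := fun _ => g (t+k/2) u) (by linarith [hh.1])
          (hci u _ _ htk ⟨by linarith [hh.1], by linarith [hh.2]⟩) (by simp)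
          (fun x hx => hmono u ⟨hx.1, by linarith [hx.2, hh.2]⟩
            ⟨by linarith, by linarith⟩ (by linarith [hx.2, hh.2]))
        simpa using this
      have h1 : Real.exp (-(∫ r in t..(t+h), g r u)) ≤ 1 := Real.exp_le_one_iff.2 (by linarith)
      have h2 := Real.add_one_le_exp (-(∫ r in t..(t+h), g r u))
      rw [Real.norm_eq_abs, abs_of_nonneg (mul_nonneg (inv_nonneg.2 hh.1.le) (by linarith)),
        inv_mul_le_iff₀ hh.1]
      linarith
    · have := hint (k/2) hk2
      rw [← lintegral_map (μ := P.restrict {ω | t ≤ T ω})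
        (f := fun u => ENNReal.ofReal (g (t + k/2) u)) (hgr _).ennreal_ofReal hU] at this
      refine ⟨(hgr _).aestronglyMeasurable, ?_⟩
      rw [hasFiniteIntegral_iff_ofReal (ae_of_all _ fun u => hgnn _ u)]
      exact this
    · refine ae_of_all _ fun u => ?_
      have hd : HasDerivWithinAt (fun x => ∫ r in t..x, g r u) (g t u) (Ici t) t := by
        apply intervalIntegral.integral_hasDerivWithinAt_right (t := Ioi t) (by simp)
        · exact ⟨univ, univ_mem, (hg.comp
            (measurable_id.prodMk measurable_const)).aestronglyMeasurable⟩
        · have h1 : ContinuousWithinAt (fun r => g r u) (Icc t (t+k)) t := hcont u t htk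
          exact h1.mono_of_mem_nhdsWithin (Icc_mem_nhdsGT (by linarith))
      have hd2 : HasDerivWithinAt (fun x => 1 - Real.exp (-(∫ r in t..x, g r u))) (g t u)
          (Ici t) t := by
        have := (hd.neg.exp).const_sub 1
        simpa using this
      have hd3 := (hasDerivWithinAt_iff_tendsto_slope' (by simp)).1 hd2.Ioi_of_Ici
      have hmap : Tendsto (fun h : ℝ => t + h) (𝓝[>] 0) (𝓝[>] t) := by
        apply tendsto_nhdsWithin_of_tendsto_nhds_of_eventually_within
        · have : Tendsto (fun h : ℝ => t + h) (𝓝 0) (𝓝 (t+0)) :=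
            (continuous_const.add continuous_id).tendsto 0
          rw [add_zero] at this
          exact this.mono_left nhdsWithin_le_nhds
        · filter_upwards [self_mem_nhdsWithin] with h hh
          have hh : 0 < h := hh
          show t < t + h
          linarith
      refine (hd3.comp hmap).congr fun h => ?_
      simp [slope_def_field, div_eq_inv_mul]
  have hfin : (∫ ω in {ω | t ≤ T ω}, g t (U ω) ∂P) = ∫ u, g t u ∂ν := by
    rw [hν, integral_map hU.aemeasurable (hgr t).aestronglyMeasurable]
  rw [hfin]
  refine (hlim.div_const _).congr' ?_
  filter_upwards [Ioo_mem_nhdsGT hk] with h hh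
  rw [ProbabilityTheory.cond_apply (hTs t)]
  have e : {ω | t ≤ T ω} ∩ {ω | T ω ∈ Ico t (t+h)} = {ω | T ω ∈ Ico t (t+h)} := by
    ext ω; simp
  rw [e, ENNReal.toReal_mul, ENNReal.toReal_inv, hIco h hh.1.le hh.2.le, integral_const_mul]
  ring


/-- Corollary 4.1.1: under a homogeneous multiplicative causal effect `f1(t)`,
the marginal causal hazard ratio equals `f1(t)` times the ratio of conditional expected
frailty factors among survivors in the two worlds. -/
theorem mchr_effect_homogeneity
    {Ω : Type*} [MeasurableSpace Ω] (P : Measure Ω) [IsProbabilityMeasure P]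
    (U0 : Ω → ℝ) (hU0 : Measurable U0)
    (Ta T0 : Ω → ℝ) (hTa : Measurable Ta) (hT0 : Measurable T0)
    (hTann : ∀ ω, 0 ≤ Ta ω) (hT0nn : ∀ ω, 0 ≤ T0 ω)
    (f0 : ℝ → ℝ → ℝ) (f1 : ℝ → ℝ)
    (hf0 : Measurable (Function.uncurry f0)) (hf1 : Measurable f1)
    (hf0nn : ∀ s u, 0 ≤ f0 s u) (hf1nn : ∀ s, 0 ≤ f1 s)
    (Λa : ℝ → ℝ → ℝ) (hΛa : ∀ s u0, Λa s u0 = ∫ r in (0:ℝ)..s, f0 r u0 * f1 r)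
    (Λ0 : ℝ → ℝ → ℝ) (hΛ0 : ∀ s u0, Λ0 s u0 = ∫ r in (0:ℝ)..s, f0 r u0)
    (hsurva : ∀ s : ℝ, 0 ≤ s → ∀ B : Set ℝ, MeasurableSet B →
      (P {ω | s ≤ Ta ω ∧ U0 ω ∈ B}).toReal
        = ∫ ω, B.indicator (fun _ => (1:ℝ)) (U0 ω) * Real.exp (-(Λa s (U0 ω))) ∂P)
    (hsurv0 : ∀ s : ℝ, 0 ≤ s → ∀ B : Set ℝ, MeasurableSet B →
      (P {ω | s ≤ T0 ω ∧ U0 ω ∈ B}).toReal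
        = ∫ ω, B.indicator (fun _ => (1:ℝ)) (U0 ω) * Real.exp (-(Λ0 s (U0 ω))) ∂P)
    (t : ℝ) (ht : 0 < t) (htilde : ℝ) (hhtilde : 0 < htilde)
    (hmonoa : ∀ u0, MonotoneOn (fun s => f0 s u0 * f1 s) (Icc t (t + htilde)))
    (hconta : ∀ u0, ContinuousOn (fun s => f0 s u0 * f1 s) (Icc t (t + htilde)))
    (hmono0 : ∀ u0, MonotoneOn (fun s => f0 s u0) (Icc t (t + htilde)))
    (hcont0 : ∀ u0, ContinuousOn (fun s => f0 s u0) (Icc t (t + htilde)))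
    (hinta : ∀ h : ℝ, h ∈ Ioo 0 htilde →
      ∫⁻ ω in {ω | t ≤ Ta ω}, ENNReal.ofReal (f0 (t + h) (U0 ω) * f1 (t + h)) ∂P < ⊤)
    (hint0 : ∀ h : ℝ, h ∈ Ioo 0 htilde →
      ∫⁻ ω in {ω | t ≤ T0 ω}, ENNReal.ofReal (f0 (t + h) (U0 ω)) ∂P < ⊤)
    (hposa : 0 < P {ω | t ≤ Ta ω}) (hpos0 : 0 < P {ω | t ≤ T0 ω})
    (hden : 0 < ∫ ω, f0 t (U0 ω) * Real.exp (-(Λ0 t (U0 ω))) ∂P) :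
    ∃ lamA lam0 : ℝ,
      Tendsto
        (fun h : ℝ => h⁻¹ * ((ProbabilityTheory.cond P {ω | t ≤ Ta ω})
            {ω | Ta ω ∈ Ico t (t + h)}).toReal)
        (𝓝[>] 0) (𝓝 lamA) ∧
      Tendsto
        (fun h : ℝ => h⁻¹ * ((ProbabilityTheory.cond P {ω | t ≤ T0 ω})
            {ω | T0 ω ∈ Ico t (t + h)}).toReal)
        (𝓝[>] 0) (𝓝 lam0) ∧
      lamA / lam0
        = ((∫ ω in {ω | t ≤ Ta ω}, f0 t (U0 ω) ∂P) / (P {ω | t ≤ Ta ω}).toReal)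
            / ((∫ ω in {ω | t ≤ T0 ω}, f0 t (U0 ω) ∂P) / (P {ω | t ≤ T0 ω}).toReal)
          * f1 t := by
  have hA := aux_hazard P U0 hU0 Ta hTa (fun s u => f0 s u * f1 s)
    (hf0.mul (hf1.comp measurable_fst)) (fun s u => mul_nonneg (hf0nn s u) (hf1nn s))
    Λa hΛa hsurva t ht htilde hhtilde hmonoa hconta hinta
  have h0 := aux_hazard P U0 hU0 T0 hT0 f0 hf0 hf0nn
    Λ0 hΛ0 hsurv0 t ht htilde hhtilde hmono0 hcont0 hint0
  refine ⟨_, _, hA, h0, ?_⟩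
  rw [integral_mul_const]
  ring
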